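/- Let k and m be positive integers and let φ : ℍ×ℂ → ℂ be holomorphic and satisfy φ|_{k,m}γ = φ for every γ ∈ Γ^J. Define Oφ = D_τφ − (k/12)E₂φ − J₁D_zφ + mJ₂φ on D' = {(τ,z) ∈ ℍ×ℂ : |Im z| < Im τ and e^{2πiz} ≠ 1}. Then for every γ ∈ Γ^J and every (τ,z) ∈ D' such that γ·(τ,z) ∈ D', one has ((Oφ)|_{k+2,m}γ)(τ,z) = (Oφ)(τ,z); i.e., the Oberdieck derivative of a Jacobi-invariant function of weight k and index m is Jacobi-invariant of weight k+2 and index m. -/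

import Mathlib

noncomputable section

open Complex MeasureTheory Set
open scoped ComplexConjugate

/-- `e w = exp (2 π i w)`. -/
def e (w : ℂ) : ℂ := Complex.exp (2 * (Real.pi : ℂ) * Complex.I * w)

/-- The monomial `q^n ζ^r`, i.e. `(τ, z) ↦ e^{2πi(nτ + rz)}`. -/
def Qmon (n : ℕ) (r : ℤ) (τ z : ℂ) : ℂ := e ((n : ℂ) * τ + (r : ℂ) * z)

/-- `σ₁(n)`, the sum of the positive divisors of `n`. -/
def sigma1 (n : ℕ) : ℕ := ∑ d ∈ n.divisors, d

/-- The weight-2 Eisenstein series `E₂(τ) = 1 - 24 ∑_{n ≥ 1} σ₁(n) e^{2πinτ}`. -/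
def E2 (τ : ℂ) : ℂ := 1 - 24 * ∑' n : ℕ, (sigma1 (n + 1) : ℂ) * e (((n : ℂ) + 1) * τ)

/-- The deformed Eisenstein series
`J₁(τ,z) = ζ/(ζ-1) - 1/2 - ∑_{a,b ≥ 1} (ζ^a - ζ^{-a}) q^{ab}`. -/
def J1 (τ z : ℂ) : ℂ :=
  e z / (e z - 1) - 1 / 2 -
    ∑' p : ℕ × ℕ, (e (((p.1 : ℂ) + 1) * z) - e (-(((p.1 : ℂ) + 1) * z))) *
      e (((p.1 : ℂ) + 1) * ((p.2 : ℂ) + 1) * τ)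

/-- The deformed Eisenstein series
`J₂(τ,z) = 1/6 - 2 ∑_{a,b ≥ 1} b (ζ^a + ζ^{-a}) q^{ab}`. -/
def J2 (τ z : ℂ) : ℂ :=
  1 / 6 - 2 * ∑' p : ℕ × ℕ, ((p.2 : ℂ) + 1) *
      (e (((p.1 : ℂ) + 1) * z) + e (-(((p.1 : ℂ) + 1) * z))) *
      e (((p.1 : ℂ) + 1) * ((p.2 : ℂ) + 1) * τ)

/-- `D_τ = (1/2πi) ∂/∂τ`. -/
def Dt (φ : ℂ → ℂ → ℂ) : ℂ → ℂ → ℂ :=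
  fun τ z => (1 / (2 * (Real.pi : ℂ) * Complex.I)) * deriv (fun t => φ t z) τ

/-- `D_z = (1/2πi) ∂/∂z`. -/
def Dz (φ : ℂ → ℂ → ℂ) : ℂ → ℂ → ℂ :=
  fun τ z => (1 / (2 * (Real.pi : ℂ) * Complex.I)) * deriv (fun w => φ τ w) z

/-- The slash action `φ ↦ φ|_{k,m} γ` for `γ = ((a,b;c,d),(λ,μ)) ∈ Γ^J`. -/
def slash (k m : ℤ) (a b c d lam mu : ℤ) (φ : ℂ → ℂ → ℂ) (τ z : ℂ) : ℂ :=
  ((c : ℂ) * τ + (d : ℂ)) ^ (-k) *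
    e ((m : ℂ) * (-(c : ℂ) * (z + (lam : ℂ) * τ + (mu : ℂ)) ^ 2 / ((c : ℂ) * τ + (d : ℂ)) +
        (lam : ℂ) ^ 2 * τ + 2 * (lam : ℂ) * z)) *
    φ (((a : ℂ) * τ + (b : ℂ)) / ((c : ℂ) * τ + (d : ℂ)))
      ((z + (lam : ℂ) * τ + (mu : ℂ)) / ((c : ℂ) * τ + (d : ℂ)))

/-- The domain `D' = {(τ,z) : 0 < Im τ, |Im z| < Im τ, e^{2πiz} ≠ 1}`. -/
def D' : Set (ℂ × ℂ) := {p | 0 < p.1.im ∧ |p.2.im| < p.1.im ∧ e p.2 ≠ 1}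

/-- The Oberdieck derivative `Oφ = D_τφ - (k/12)E₂φ - J₁D_zφ + mJ₂φ` of weight `k`, index `m`. -/
def Ober (k m : ℕ) (φ : ℂ → ℂ → ℂ) : ℂ → ℂ → ℂ :=
  fun τ z => Dt φ τ z - ((k : ℂ) / 12) * E2 τ * φ τ z - J1 τ z * Dz φ τ z +
    (m : ℂ) * J2 τ z * φ τ z

/-- The heat operator `L_m = 4m D_τ - D_z²`. -/
def Heat (m : ℕ) (φ : ℂ → ℂ → ℂ) : ℂ → ℂ → ℂ :=
  fun τ z => 4 * (m : ℂ) * Dt φ τ z - Dz (Dz φ) τ z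

/-- The modified heat operator `L_{k,m} = L_m - (m(2k-1)/6) E₂`. -/
def HeatE (k m : ℕ) (φ : ℂ → ℂ → ℂ) : ℂ → ℂ → ℂ :=
  fun τ z => Heat m φ τ z - (m : ℂ) * (2 * (k : ℂ) - 1) / 6 * E2 τ * φ τ z

/-- The Jacobi–Serre derivative of weight `k` and index `m`. -/
def JSerre (k m : ℕ) (φ : ℂ → ℂ → ℂ) : ℂ → ℂ → ℂ :=
  fun τ z => Dt φ τ z - ((k : ℂ) / 12) * E2 τ * φ τ z +
    (1 / (1 - 4 * (m : ℂ))) *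
      (Dz (Dz φ) τ z - J1 τ z * Dz φ τ z + (m : ℂ) * J2 τ z * φ τ z -
        ((m : ℂ) / 6) * E2 τ * φ τ z)

/-- The error function `erf a = (2/√π) ∫₀^a e^{-t²} dt`. -/
def erf (a : ℝ) : ℝ := 2 / Real.sqrt Real.pi * ∫ t in (0 : ℝ)..a, Real.exp (-t ^ 2)

/-- Euler's integral for `₂F₁(1/2, k+1; 3/2; x)`:
`F_k(x) = (1/2) ∫₀¹ t^{-1/2} (1 - xt)^{-(k+1)} dt`. -/
def Fk (k x : ℝ) : ℝ := (1 / 2) * ∫ t in (0 : ℝ)..1, t ^ (-(1 : ℝ) / 2) * (1 - x * t) ^ (-(k + 1))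

/-- The integration region `(u,v,x,y) ∈ [0,1] × (0,∞) × [0,1] × ℝ`. -/
def Reg : Set (ℝ × ℝ × ℝ × ℝ) := Icc 0 1 ×ˢ Ioi 0 ×ˢ Icc 0 1 ×ˢ univ

/-- The Fourier series `φ(τ,z) = ∑_{n,r} c(n,r) q^n ζ^r`. -/
def phiF (c : ℕ → ℤ → ℂ) (τ z : ℂ) : ℂ :=
  ∑' p : ℕ × ℤ, c p.1 p.2 * e ((p.1 : ℂ) * τ + (p.2 : ℂ) * z)

open Filter Topology

lemma e_add (u v : ℂ) : e (u + v) = e u * e v := by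
  simp only [e, mul_add, Complex.exp_add]

lemma e_ne_zero (u : ℂ) : e u ≠ 0 := Complex.exp_ne_zero _

lemma e_neg (u : ℂ) : e (-u) = (e u)⁻¹ := by
  simp only [e, mul_neg, Complex.exp_neg]

lemma e_natCast_mul (n : ℕ) (u : ℂ) : e (n * u) = e u ^ n := by
  simp only [e]
  rw [← Complex.exp_nat_mul]
  ring_nf

lemma e_eq_one_iff (u : ℂ) : e u = 1 ↔ ∃ n : ℤ, u = n := by
  have h : (2 * (Real.pi : ℂ) * Complex.I) ≠ 0 := Complex.two_pi_I_ne_zero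
  rw [e, Complex.exp_eq_one_iff]
  refine exists_congr fun n => ⟨fun hn => ?_, fun hn => by rw [hn]; ring⟩
  exact mul_left_cancel₀ h (hn.trans (mul_comm _ _))

lemma e_intCast (n : ℤ) : e n = 1 := (e_eq_one_iff _).2 ⟨n, rfl⟩

lemma norm_e (u : ℂ) : ‖e u‖ = Real.exp (-(2 * Real.pi * u.im)) := by
  simp [e, Complex.norm_exp]

lemma norm_e_lt_one {u : ℂ} (hu : 0 < u.im) : ‖e u‖ < 1 := by
  rw [norm_e, Real.exp_lt_one_iff]
  have := Real.pi_pos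
  have : 0 < 2 * Real.pi * u.im := by positivity
  linarith

lemma hasDerivAt_e (u : ℂ) : HasDerivAt e (2 * Real.pi * Complex.I * e u) u := by
  have h := ((hasDerivAt_id u).const_mul (2 * (Real.pi : ℂ) * Complex.I)).cexp
  exact h.congr_deriv (by simp only [id, e]; ring)

lemma differentiable_e : Differentiable ℂ e := fun u => (hasDerivAt_e u).differentiableAt

/-- `z` lies in the lattice `ℤτ + ℤ`. -/
def OnLattice (τ z : ℂ) : Prop := ∃ m n : ℤ, z = m * τ + n

lemma onLattice_iff {τ z : ℂ} : OnLattice τ z ↔ ∃ m : ℤ, e (z - m * τ) = 1 := by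
  simp only [e_eq_one_iff, OnLattice, sub_eq_iff_eq_add']

lemma onLattice_add_iff {τ z : ℂ} (m n : ℤ) :
    OnLattice τ (z + (m * τ + n)) ↔ OnLattice τ z := by
  constructor
  · rintro ⟨a, b, h⟩
    exact ⟨a - m, b - n, by push_cast; linear_combination h⟩
  · rintro ⟨a, b, h⟩
    exact ⟨a + m, b + n, by push_cast; linear_combination h⟩

/-- The integer `n` for which `z - nτ` has imaginary part in `[0, Im τ)`. -/
def level (τ z : ℂ) : ℤ := ⌊z.im / τ.im⌋

lemma level_bounds {τ : ℂ} (hτ : 0 < τ.im) (z : ℂ) :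
    0 ≤ (z - level τ z * τ).im ∧ (z - level τ z * τ).im < τ.im := by
  have h1 := Int.floor_le (z.im / τ.im)
  have h2 := Int.lt_floor_add_one (z.im / τ.im)
  rw [le_div_iff₀ hτ] at h1
  rw [div_lt_iff₀ hτ] at h2
  simp only [level, Complex.sub_im, Complex.mul_im, Complex.intCast_re, Complex.intCast_im]
  constructor <;> linarith

lemma level_add {τ : ℂ} (hτ : 0 < τ.im) (z : ℂ) (m n : ℤ) :
    level τ (z + (m * τ + n)) = level τ z + m := by
  have h : (z + (m * τ + n)).im / τ.im = z.im / τ.im + m := by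
    simp only [Complex.add_im, Complex.mul_im, Complex.intCast_re, Complex.intCast_im]
    field_simp
    ring
  rw [level, h, Int.floor_add_intCast, level]

lemma eventually_abs_im_lt {τ : ℂ} (hτ : 0 < τ.im) (z₀ : ℂ) :
    ∀ᶠ z in 𝓝 z₀, |(z - level τ z₀ * τ).im| < τ.im := by
  have hc : Continuous fun z : ℂ => |(z - level τ z₀ * τ).im| := by fun_prop
  have hb := level_bounds hτ z₀
  exact hc.continuousAt.eventually_lt continuousAt_const (by rw [abs_of_nonneg hb.1]; exact hb.2)

lemma onLattice_iff_of_abs_im_lt {τ z : ℂ} (n : ℤ)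
    (h : |(z - n * τ).im| < τ.im) : OnLattice τ z ↔ e (z - n * τ) = 1 := by
  refine ⟨?_, fun h => onLattice_iff.2 ⟨n, h⟩⟩
  rintro ⟨a, b, rfl⟩
  have hτ : 0 < τ.im := (abs_nonneg _).trans_lt h
  have him : (a * τ + b - n * τ).im = ((a - n : ℤ) : ℝ) * τ.im := by
    simp only [Complex.sub_im, Complex.add_im, Complex.mul_im, Complex.intCast_re,
      Complex.intCast_im]
    push_cast
    ring
  rw [him, abs_mul, abs_of_pos hτ, mul_lt_iff_lt_one_left hτ] at h
  have h0 : a - n = 0 := by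
    rw [← Int.abs_lt_one_iff]
    exact_mod_cast h
  obtain rfl : a = n := by omega
  rw [show (a : ℂ) * τ + b - a * τ = b by ring, e_intCast]

lemma eventually_not_onLattice {τ : ℂ} (hτ : 0 < τ.im) (z₀ : ℂ) :
    ∀ᶠ z in 𝓝[≠] z₀, ¬ OnLattice τ z := by
  have hd : HasDerivAt (fun z => e (z - level τ z₀ * τ))
      (2 * Real.pi * Complex.I * e (z₀ - level τ z₀ * τ)) z₀ :=
    HasDerivAt.comp_sub_const _ _ (hasDerivAt_e _)
  have hne := hd.eventually_ne (c := 1) (mul_ne_zero Complex.two_pi_I_ne_zero (e_ne_zero _))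
  filter_upwards [hne, (eventually_abs_im_lt hτ z₀).filter_mono nhdsWithin_le_nhds] with z h1 h2
  rwa [onLattice_iff_of_abs_im_lt _ h2]

/-- A continuous function with periods `1` and `τ` is bounded. -/
lemma isBounded_range_of_periodic {τ : ℂ} (hτ : 0 < τ.im) {D : ℂ → ℂ} (hD : Continuous D)
    (hper : ∀ (m n : ℤ) z, D (z + (m * τ + n)) = D z) : Bornology.IsBounded (range D) := by
  have hK : IsCompact ((fun p : ℝ × ℝ => (p.1 : ℂ) * τ + p.2) '' (Icc 0 1 ×ˢ Icc 0 1)) :=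
    (isCompact_Icc.prod isCompact_Icc).image (by fun_prop)
  refine (hK.image hD).isBounded.subset ?_
  rintro _ ⟨z, rfl⟩
  set s : ℝ := z.im / τ.im
  set t : ℝ := z.re - s * τ.re
  have hz : z = s * τ + t := by
    have : s * τ.im = z.im := div_mul_cancel₀ _ hτ.ne'
    apply Complex.ext <;> simp [t, this]
  refine ⟨Int.fract s * τ + Int.fract t, ⟨(Int.fract s, Int.fract t), ?_, rfl⟩, ?_⟩
  · exact ⟨⟨Int.fract_nonneg _, (Int.fract_lt_one _).le⟩,
      ⟨Int.fract_nonneg _, (Int.fract_lt_one _).le⟩⟩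
  · rw [← hper ⌊s⌋ ⌊t⌋]
    congr 1
    rw [hz]
    have hfract : ∀ x : ℝ, ((Int.fract x : ℝ) : ℂ) = x - ⌊x⌋ := fun x => by
      rw [← Int.self_sub_floor]; push_cast; rfl
    simp only [hfract]
    ring

/-- A function with periods `1` and `τ` that is holomorphic off the lattice and has a limit at `0`
is constant off the lattice. -/
lemma eq_of_periodic_of_tendsto {τ : ℂ} (hτ : 0 < τ.im) {D : ℂ → ℂ} {v : ℂ}
    (hper : ∀ (m n : ℤ) z, D (z + (m * τ + n)) = D z)
    (hD : ∀ z, ¬ OnLattice τ z → DifferentiableAt ℂ D z)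
    (hv : Tendsto D (𝓝[≠] 0) (𝓝 v)) {z : ℂ} (hz : ¬ OnLattice τ z) : D z = v := by
  classical
  set G : ℂ → ℂ := fun z => if OnLattice τ z then v else D z with hG
  have hG0 : G 0 = v := if_pos ⟨0, 0, by simp⟩
  have hGper : ∀ (m n : ℤ) z, G (z + (m * τ + n)) = G z := fun m n z => by
    simp only [hG, onLattice_add_iff, hper]
  have hGne : ∀ w, ¬ OnLattice τ w → DifferentiableAt ℂ G w := fun w hw => by
    have hev : ∀ᶠ y in 𝓝 w, ¬ OnLattice τ y := by
      rw [← nhdsNE_sup_pure, eventually_sup]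
      exact ⟨eventually_not_onLattice hτ w, by simpa using hw⟩
    exact (hD w hw).congr_of_eventuallyEq (hev.mono fun y hy => if_neg hy)
  have hGzero : DifferentiableAt ℂ G 0 := by
    refine (Complex.analyticAt_of_differentiable_on_punctured_nhds_of_continuousAt
      ((eventually_not_onLattice hτ 0).mono hGne) ?_).differentiableAt
    rw [← continuousWithinAt_compl_self, ContinuousWithinAt, hG0]
    refine hv.congr' ((eventually_not_onLattice hτ 0).mono fun y hy => ?_)
    exact (if_neg hy).symm
  have hGd : Differentiable ℂ G := fun w => by
    by_cases hw : OnLattice τ w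
    · obtain ⟨m, n, rfl⟩ := hw
      have h : G = fun y => G (y - (m * τ + n)) := by
        funext y
        rw [← hGper m n (y - (m * τ + n)), sub_add_cancel]
      rw [h]
      have h0 : DifferentiableAt ℂ G ((m * τ + n) - (m * τ + n)) := by rwa [sub_self]
      exact differentiableAt_comp_sub_const.2 h0
    · exact hGne w hw
  have := hGd.apply_eq_apply_of_bounded
    (isBounded_range_of_periodic hτ hGd.continuous hGper) z 0
  rw [hG0] at this
  exact (if_neg hz).symm.trans this

/-- The extension to `ℂ` of a function `f` on the strip `|Im z| < Im τ` with
`f (z + τ) = f z + s`. -/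
def glue (τ : ℂ) (f : ℂ → ℂ) (s z : ℂ) : ℂ := f (z - level τ z * τ) + level τ z * s

section glue

variable {τ : ℂ} {f : ℂ → ℂ} {s : ℂ}

lemma glue_add (hτ : 0 < τ.im) (hf : ∀ (n : ℤ) z, f (z + n) = f z) (m n : ℤ) (z : ℂ) :
    glue τ f s (z + (m * τ + n)) = glue τ f s z + m * s := by
  rw [glue, level_add hτ, glue, ← hf n (z - level τ z * τ)]
  push_cast
  rw [show z + (m * τ + n) - (level τ z + m) * τ = z - level τ z * τ + n by ring]
  ring

lemma glue_eq (hshift : ∀ z : ℂ, -τ.im < z.im → z.im < 0 → f (z + τ) = f z + s) {z : ℂ} (n : ℤ)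
    (hn : |(z - n * τ).im| < τ.im) : glue τ f s z = f (z - n * τ) + n * s := by
  have hτ : 0 < τ.im := (abs_nonneg _).trans_lt hn
  obtain ⟨h1, h2⟩ := level_bounds hτ z
  rw [abs_lt] at hn
  obtain ⟨h3, h4⟩ := hn
  have hsplit : z - level τ z * τ = z - n * τ + ((n - level τ z : ℤ) : ℂ) * τ := by
    push_cast; ring
  have him : (z - level τ z * τ).im = (z - n * τ).im + ((n - level τ z : ℤ) : ℝ) * τ.im := by
    rw [hsplit]
    simp only [Complex.add_im, Complex.mul_im, Complex.intCast_re, Complex.intCast_im]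
    ring
  have h5 : ((n - level τ z : ℤ) : ℝ) < 2 := by
    by_contra! h
    nlinarith
  have h6 : (-1 : ℝ) < ((n - level τ z : ℤ) : ℝ) := by
    by_contra! h
    nlinarith
  have h5' : n - level τ z < 2 := by exact_mod_cast h5
  have h6' : -1 < n - level τ z := by exact_mod_cast h6
  obtain h | h : n - level τ z = 0 ∨ n - level τ z = 1 := by omega
  · obtain rfl : n = level τ z := by omega
    rfl
  · rw [h] at him hsplit
    rw [glue, hsplit, show level τ z = n - 1 by omega]
    push_cast at him ⊢
    rw [one_mul, hshift _ h3 (by linarith)]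
    ring

lemma glue_eq_self (hshift : ∀ z : ℂ, -τ.im < z.im → z.im < 0 → f (z + τ) = f z + s) {z : ℂ}
    (hz : |z.im| < τ.im) : glue τ f s z = f z := by
  simpa using glue_eq hshift 0 (by simpa using hz)

lemma differentiableAt_glue (hτ : 0 < τ.im)
    (hshift : ∀ z : ℂ, -τ.im < z.im → z.im < 0 → f (z + τ) = f z + s)
    (hd : ∀ z : ℂ, |z.im| < τ.im → e z ≠ 1 → DifferentiableAt ℂ f z) {z : ℂ}
    (hz : ¬ OnLattice τ z) : DifferentiableAt ℂ (glue τ f s) z := by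
  have hev := eventually_abs_im_lt hτ z
  have h0 := hev.self_of_nhds
  have hdz : DifferentiableAt ℂ (fun y => f (y - level τ z * τ) + level τ z * s) z :=
    (differentiableAt_comp_sub_const.2
      (hd _ h0 (mt (onLattice_iff_of_abs_im_lt _ h0).2 hz))).add_const _
  exact hdz.congr_of_eventuallyEq (hev.mono fun y hy => glue_eq hshift _ hy)

end glue

section Lambert

/-- The monomial `ζ^a q^{ab}` with `ζ = e u`, `q = e τ` and `(a, b) = p + (1, 1)`. -/
def lambertTerm (τ u : ℂ) (p : ℕ × ℕ) : ℂ :=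
  e (((p.1 : ℂ) + 1) * u) * e (((p.1 : ℂ) + 1) * ((p.2 : ℂ) + 1) * τ)

/-- The weighted Lambert series `∑_{a,b ≥ 1} c(a-1,b-1) ζ^a q^{ab}`. -/
def lambert (c : ℕ × ℕ → ℂ) (τ u : ℂ) : ℂ := ∑' p, c p * lambertTerm τ u p

variable {τ : ℂ} {c : ℕ × ℕ → ℂ}

lemma lambertTerm_eq (τ u : ℂ) (p : ℕ × ℕ) :
    lambertTerm τ u p = e (u + τ) ^ (p.1 + 1) * e τ ^ ((p.1 + 1) * p.2) := by
  rw [lambertTerm, ← e_natCast_mul, ← e_natCast_mul, ← e_add, ← e_add]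
  congr 1
  push_cast
  ring

lemma lambertTerm_add_right (τ u : ℂ) (p : ℕ × ℕ) :
    lambertTerm τ (u + τ) p = lambertTerm τ u (p.1, p.2 + 1) := by
  rw [lambertTerm, lambertTerm, ← e_add, ← e_add]
  congr 1
  push_cast
  ring

lemma summable_lambert_majorant {r s : ℝ} (hr : 0 ≤ r) (hr1 : r < 1) (hs : 0 ≤ s) (hs1 : s < 1) :
    Summable fun p : ℕ × ℕ => (((p.1 : ℝ) + 1) * r ^ p.1) * (((p.2 : ℝ) + 1) * s ^ p.2) := by
  have key : ∀ t : ℝ, 0 ≤ t → t < 1 → Summable fun n : ℕ => ((n : ℝ) + 1) * t ^ n := by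
    intro t ht ht1
    have h1 := summable_pow_mul_geometric_of_norm_lt_one 1
      (by rwa [Real.norm_of_nonneg ht] : ‖t‖ < 1)
    refine (h1.add (summable_geometric_of_lt_one ht ht1)).congr fun n => ?_
    ring
  exact (key r hr hr1).mul_of_nonneg (key s hs hs1) (fun n => by positivity) (fun n => by positivity)

lemma norm_mul_lambertTerm_le (hτ : 0 < τ.im)
    (hc : ∀ p : ℕ × ℕ, ‖c p‖ ≤ ((p.1 : ℝ) + 1) * ((p.2 : ℝ) + 1)) {u : ℂ} {r : ℝ}
    (hr1 : r ≤ 1) (hu : ‖e (u + τ)‖ ≤ r) (p : ℕ × ℕ) :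
    ‖c p * lambertTerm τ u p‖ ≤
      (((p.1 : ℝ) + 1) * r ^ p.1) * (((p.2 : ℝ) + 1) * ‖e τ‖ ^ p.2) := by
  have hr0 : 0 ≤ r := (norm_nonneg _).trans hu
  have h1 : ‖e (u + τ)‖ ^ (p.1 + 1) ≤ r ^ p.1 := by
    calc ‖e (u + τ)‖ ^ (p.1 + 1) ≤ r ^ (p.1 + 1) := by gcongr
      _ ≤ r ^ p.1 := pow_le_pow_of_le_one hr0 hr1 (Nat.le_succ _)
  have h2 : ‖e τ‖ ^ ((p.1 + 1) * p.2) ≤ ‖e τ‖ ^ p.2 :=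
    pow_le_pow_of_le_one (norm_nonneg _) (norm_e_lt_one hτ).le
      (Nat.le_mul_of_pos_left _ (Nat.succ_pos _))
  rw [lambertTerm_eq, norm_mul, norm_mul, norm_pow, norm_pow]
  calc ‖c p‖ * (‖e (u + τ)‖ ^ (p.1 + 1) * ‖e τ‖ ^ ((p.1 + 1) * p.2))
      ≤ (((p.1 : ℝ) + 1) * ((p.2 : ℝ) + 1)) * (r ^ p.1 * ‖e τ‖ ^ p.2) := by
        gcongr
        exact hc p
    _ = _ := by ring

lemma summable_lambert (hτ : 0 < τ.im)
    (hc : ∀ p : ℕ × ℕ, ‖c p‖ ≤ ((p.1 : ℝ) + 1) * ((p.2 : ℝ) + 1)) {u : ℂ} (hu : -τ.im < u.im) :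
    Summable fun p => c p * lambertTerm τ u p := by
  have h1 : ‖e (u + τ)‖ < 1 := norm_e_lt_one (by rw [Complex.add_im]; linarith)
  exact (summable_lambert_majorant (norm_nonneg _) h1 (norm_nonneg _)
    (norm_e_lt_one hτ)).of_norm_bounded (norm_mul_lambertTerm_le hτ hc h1.le le_rfl)

lemma hasDerivAt_lambertTerm (τ u : ℂ) (p : ℕ × ℕ) :
    HasDerivAt (fun u => lambertTerm τ u p)
      (2 * Real.pi * Complex.I * (((p.1 : ℂ) + 1) * lambertTerm τ u p)) u := by
  have h := ((hasDerivAt_e _).comp u ((hasDerivAt_id u).const_mul ((p.1 : ℂ) + 1))).mul_const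
    (e (((p.1 : ℂ) + 1) * ((p.2 : ℂ) + 1) * τ))
  refine h.congr_deriv ?_
  simp only [lambertTerm, id]
  ring

/-- A half-plane around `u` on which the Lambert series converges uniformly. -/
lemma exists_lambert_bound (hτ : 0 < τ.im)
    (hc : ∀ p : ℕ × ℕ, ‖c p‖ ≤ ((p.1 : ℝ) + 1) * ((p.2 : ℝ) + 1)) {u : ℂ} (hu : -τ.im < u.im) :
    ∃ (U : Set ℂ) (b : ℕ × ℕ → ℝ), IsOpen U ∧ u ∈ U ∧ Summable b ∧
      ∀ p, ∀ w ∈ U, ‖c p * lambertTerm τ w p‖ ≤ b p := by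
  obtain ⟨δ, h1, h2⟩ := exists_between hu
  have hr : Real.exp (-(2 * Real.pi * (δ + τ.im))) < 1 := by
    rw [Real.exp_lt_one_iff]
    have := Real.pi_pos
    have : 0 < 2 * Real.pi * (δ + τ.im) := mul_pos (by positivity) (by linarith)
    linarith
  refine ⟨{w | δ < w.im}, _, isOpen_lt continuous_const Complex.continuous_im, h2,
    summable_lambert_majorant (Real.exp_pos _).le hr (norm_nonneg _) (norm_e_lt_one hτ),
    fun p w hw => norm_mul_lambertTerm_le hτ hc hr.le ?_ p⟩
  rw [norm_e, Complex.add_im]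
  have : δ ≤ w.im := le_of_lt hw
  gcongr

lemma differentiableAt_lambert (hτ : 0 < τ.im)
    (hc : ∀ p : ℕ × ℕ, ‖c p‖ ≤ ((p.1 : ℝ) + 1) * ((p.2 : ℝ) + 1)) {u : ℂ} (hu : -τ.im < u.im) :
    DifferentiableAt ℂ (lambert c τ) u := by
  obtain ⟨U, b, hU, huU, hb, hle⟩ := exists_lambert_bound hτ hc hu
  exact (Complex.differentiableOn_tsum_of_summable_norm hb (fun p w _ =>
    ((hasDerivAt_lambertTerm τ w p).const_mul (c p)).differentiableAt.differentiableWithinAt)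
    hU hle).differentiableAt (hU.mem_nhds huU)

lemma hasDerivAt_lambert (hτ : 0 < τ.im)
    (hc : ∀ p : ℕ × ℕ, ‖c p‖ ≤ ((p.1 : ℝ) + 1) * ((p.2 : ℝ) + 1)) {u : ℂ} (hu : -τ.im < u.im) :
    HasDerivAt (lambert c τ)
      (2 * Real.pi * Complex.I * lambert (fun p => ((p.1 : ℂ) + 1) * c p) τ u) u := by
  obtain ⟨U, b, hU, huU, hb, hle⟩ := exists_lambert_bound hτ hc hu
  have hs := Complex.hasSum_deriv_of_summable_norm hb (fun p w _ =>
    ((hasDerivAt_lambertTerm τ w p).const_mul (c p)).differentiableAt.differentiableWithinAt)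
    hU hle huU
  refine (differentiableAt_lambert hτ hc hu).hasDerivAt.congr_deriv ?_
  rw [lambert, ← tsum_mul_left]
  refine hs.tsum_eq.symm.trans (tsum_congr fun p => ?_)
  rw [((hasDerivAt_lambertTerm τ u p).const_mul (c p)).deriv]
  ring

/-- Splitting off the terms with `b = 1` in a double series. -/
lemma tsum_prod_eq_add {f : ℕ × ℕ → ℂ} (hf : Summable f) :
    ∑' p, f p = ∑' n, f (n, 0) + ∑' p : ℕ × ℕ, f (p.1, p.2 + 1) := by
  have h0 : Summable fun n => f (n, 0) := hf.comp_injective (Prod.mk_left_injective 0)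
  have h1 : Summable fun p : ℕ × ℕ => f (p.1, p.2 + 1) :=
    hf.comp_injective (i := fun p : ℕ × ℕ => (p.1, p.2 + 1)) fun p p' h => by
      simpa [Prod.ext_iff] using h
  rw [hf.tsum_prod, h1.tsum_prod, ← h0.tsum_add h1.prod]
  exact tsum_congr fun n => (hf.prod_factor n).tsum_eq_zero_add

lemma tsum_lambertTerm_zero {u : ℂ} (hu : -τ.im < u.im) :
    ∑' n, lambertTerm τ u (n, 0) = e (u + τ) / (1 - e (u + τ)) := by
  have h1 : ‖e (u + τ)‖ < 1 := norm_e_lt_one (by rw [Complex.add_im]; linarith)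
  simp only [lambertTerm_eq, mul_zero, pow_zero, mul_one, pow_succ]
  rw [tsum_mul_right, tsum_geometric_of_norm_lt_one h1]
  ring

lemma norm_one_le_weight (p : ℕ × ℕ) :
    ‖(1 : ℂ)‖ ≤ ((p.1 : ℝ) + 1) * ((p.2 : ℝ) + 1) := by
  rw [norm_one]
  nlinarith [(p.1.cast_nonneg : (0 : ℝ) ≤ p.1), (p.2.cast_nonneg : (0 : ℝ) ≤ p.2),
    mul_nonneg (p.1.cast_nonneg : (0 : ℝ) ≤ p.1) (p.2.cast_nonneg : (0 : ℝ) ≤ p.2)]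

lemma norm_snd_le_weight (p : ℕ × ℕ) :
    ‖(p.2 : ℂ) + 1‖ ≤ ((p.1 : ℝ) + 1) * ((p.2 : ℝ) + 1) := by
  have h : ‖(p.2 : ℂ) + 1‖ = (p.2 : ℝ) + 1 := by
    have := Complex.norm_natCast (p.2 + 1)
    push_cast at this
    exact this
  rw [h]
  nlinarith [mul_nonneg (p.1.cast_nonneg : (0 : ℝ) ≤ p.1) (p.2.cast_nonneg : (0 : ℝ) ≤ p.2),
    (p.1.cast_nonneg : (0 : ℝ) ≤ p.1)]

lemma lambert_one_add (hτ : 0 < τ.im) {u : ℂ} (hu : -τ.im < u.im) :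
    lambert (fun _ => 1) τ (u + τ) =
      lambert (fun _ => 1) τ u - e (u + τ) / (1 - e (u + τ)) := by
  have hs := summable_lambert hτ norm_one_le_weight hu
  rw [lambert, lambert, tsum_prod_eq_add hs]
  simp only [one_mul, tsum_lambertTerm_zero hu, lambertTerm_add_right]
  ring

lemma lambert_snd_add (hτ : 0 < τ.im) {u : ℂ} (hu : -τ.im < u.im) :
    lambert (fun p => (p.2 : ℂ) + 1) τ (u + τ) =
      lambert (fun p => (p.2 : ℂ) + 1) τ u - lambert (fun _ => 1) τ u := by
  have h1 := summable_lambert hτ norm_one_le_weight hu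
  have h2 := summable_lambert hτ norm_snd_le_weight hu
  have hsub := tsum_prod_eq_add (h2.sub h1)
  rw [h2.tsum_sub h1] at hsub
  rw [lambert, lambert, lambert, hsub]
  simp only [lambertTerm_add_right]
  simp
  exact tsum_congr fun p => by ring

end Lambert

section Deformed

variable {τ : ℂ}

lemma J1_eq_lambert (hτ : 0 < τ.im) {z : ℂ} (hz : |z.im| < τ.im) :
    J1 τ z = e z / (e z - 1) - 1 / 2 -
      (lambert (fun _ => 1) τ z - lambert (fun _ => 1) τ (-z)) := by
  obtain ⟨h1, h2⟩ := abs_lt.1 hz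
  have s1 := summable_lambert hτ norm_one_le_weight h1
  have s2 := summable_lambert hτ norm_one_le_weight (u := -z) (by rw [Complex.neg_im]; linarith)
  rw [J1, lambert, lambert, ← s1.tsum_sub s2]
  congr 1
  refine tsum_congr fun p => ?_
  simp only [lambertTerm, mul_neg]
  ring

lemma J2_eq_lambert (hτ : 0 < τ.im) {z : ℂ} (hz : |z.im| < τ.im) :
    J2 τ z = 1 / 6 - 2 * (lambert (fun p => (p.2 : ℂ) + 1) τ z +
      lambert (fun p => (p.2 : ℂ) + 1) τ (-z)) := by
  obtain ⟨h1, h2⟩ := abs_lt.1 hz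
  have s1 := summable_lambert hτ norm_snd_le_weight h1
  have s2 := summable_lambert hτ norm_snd_le_weight (u := -z) (by rw [Complex.neg_im]; linarith)
  rw [J2, lambert, lambert, ← s1.tsum_add s2]
  congr 2
  refine tsum_congr fun p => ?_
  simp only [lambertTerm, mul_neg]
  ring

lemma e_sub_one_ne_zero {z : ℂ} (hz : e z ≠ 1) : e z - 1 ≠ 0 := sub_ne_zero.2 hz

lemma e_ne_one_of_im_ne_zero {z : ℂ} (hz : z.im ≠ 0) : e z ≠ 1 := by
  rw [Ne, e_eq_one_iff]
  rintro ⟨n, rfl⟩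
  simp at hz

lemma J1_add_tau (z : ℂ) (h1 : -τ.im < z.im) (h2 : z.im < 0) : J1 τ (z + τ) = J1 τ z - 1 := by
  have hτ : 0 < τ.im := by linarith
  have hA := lambert_one_add hτ h1
  have hB := lambert_one_add (u := -(z + τ)) hτ (by simp; linarith)
  rw [show -(z + τ) + τ = -z by ring] at hB
  rw [J1_eq_lambert hτ (z := z + τ) (by rw [abs_lt]; constructor <;> simp <;> linarith),
    J1_eq_lambert hτ (z := z) (by rw [abs_lt]; constructor <;> linarith), hA, hB, e_neg]
  have n1 : e z ≠ 1 := e_ne_one_of_im_ne_zero h2.ne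
  have n2 : e (z + τ) ≠ 1 := e_ne_one_of_im_ne_zero (by simp; linarith)
  have n3 := e_ne_zero z
  have n4 := sub_ne_zero.2 n1
  have n5 := sub_ne_zero.2 n2
  have n6 := sub_ne_zero.2 n2.symm
  have e1 : e (z + τ) / (1 - e (z + τ)) = -(e (z + τ) / (e (z + τ) - 1)) := by
    rw [← div_neg, neg_sub]
  have e2 : (e z)⁻¹ / (1 - (e z)⁻¹) = e z / (e z - 1) - 1 := by
    have : 1 - (e z)⁻¹ ≠ 0 := sub_ne_zero.2 fun h => n1 (inv_eq_one.1 h.symm)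
    field_simp
    ring
  rw [e1, e2]
  ring

lemma J2_add_tau (z : ℂ) (h1 : -τ.im < z.im) (h2 : z.im < 0) :
    J2 τ (z + τ) = J2 τ z - 2 * J1 τ z + 1 := by
  have hτ : 0 < τ.im := by linarith
  have hlow : -τ.im < (-(z + τ)).im := by simp; linarith
  have hA := lambert_one_add hτ hlow
  have hB := lambert_snd_add hτ h1
  have hC := lambert_snd_add hτ hlow
  rw [show -(z + τ) + τ = -z by ring] at hA hC
  rw [J2_eq_lambert hτ (z := z + τ) (by rw [abs_lt]; constructor <;> simp <;> linarith),
    J2_eq_lambert hτ (z := z) (by rw [abs_lt]; constructor <;> linarith),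
    J1_eq_lambert hτ (z := z) (by rw [abs_lt]; constructor <;> linarith), hB, hC, hA, e_neg]
  have n1 : e z ≠ 1 := e_ne_one_of_im_ne_zero h2.ne
  have n3 := e_ne_zero z
  have n4 := sub_ne_zero.2 n1
  have e2 : (e z)⁻¹ / (1 - (e z)⁻¹) = e z / (e z - 1) - 1 := by
    have : 1 - (e z)⁻¹ ≠ 0 := sub_ne_zero.2 fun h => n1 (inv_eq_one.1 h.symm)
    field_simp
    ring
  rw [e2]
  ring

lemma e_mul_add_intCast (a : ℕ) (z : ℂ) (n : ℤ) : e (((a : ℂ) + 1) * (z + n)) = e ((a + 1) * z) := by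
  have : ((a : ℂ) + 1) * (z + n) = (a + 1) * z + (((a + 1 : ℤ) * n : ℤ) : ℂ) := by
    push_cast; ring
  rw [this, e_add, e_intCast, mul_one]

lemma J1_add_intCast (τ : ℂ) (n : ℤ) (z : ℂ) : J1 τ (z + n) = J1 τ z := by
  simp only [J1, e_neg, e_mul_add_intCast]
  rw [e_add, e_intCast, mul_one]

lemma J2_add_intCast (τ : ℂ) (n : ℤ) (z : ℂ) : J2 τ (z + n) = J2 τ z := by
  simp only [J2, e_neg, e_mul_add_intCast]

/-- The combination `J₁² - J₂`, which is the Weierstrass function of the lattice `ℤτ + ℤ`. -/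
def J1sqSubJ2 (τ z : ℂ) : ℂ := J1 τ z ^ 2 - J2 τ z

lemma J1sqSubJ2_add_intCast (τ : ℂ) (n : ℤ) (z : ℂ) : J1sqSubJ2 τ (z + n) = J1sqSubJ2 τ z := by
  rw [J1sqSubJ2, J1sqSubJ2, J1_add_intCast, J2_add_intCast]

lemma J1sqSubJ2_add_tau (z : ℂ) (h1 : -τ.im < z.im) (h2 : z.im < 0) :
    J1sqSubJ2 τ (z + τ) = J1sqSubJ2 τ z := by
  rw [J1sqSubJ2, J1sqSubJ2, J1_add_tau z h1 h2, J2_add_tau z h1 h2]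
  ring

lemma eventually_abs_im_lt_of_abs_im_lt {z : ℂ} (hz : |z.im| < τ.im) :
    ∀ᶠ y in 𝓝 z, |y.im| < τ.im :=
  (Complex.continuous_im.abs.continuousAt.eventually_lt continuousAt_const hz)

lemma differentiableAt_J1 {z : ℂ} (hz : |z.im| < τ.im) (h1 : e z ≠ 1) :
    DifferentiableAt ℂ (J1 τ) z := by
  have hτ : 0 < τ.im := (abs_nonneg _).trans_lt hz
  have he := differentiable_e z
  have hA := differentiableAt_lambert hτ norm_one_le_weight (abs_lt.1 hz).1
  have hB : DifferentiableAt ℂ (fun y => lambert (fun _ => 1) τ (-y)) z :=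
    (differentiableAt_lambert hτ norm_one_le_weight (u := -z)
      (by rw [Complex.neg_im]; linarith [(abs_lt.1 hz).2])).comp z differentiableAt_id.neg
  have h : DifferentiableAt ℂ (fun z => e z / (e z - 1) - 1 / 2 -
      (lambert (fun _ => 1) τ z - lambert (fun _ => 1) τ (-z))) z :=
    ((he.div (he.sub_const 1) (e_sub_one_ne_zero h1)).sub_const _).sub (hA.sub hB)
  exact h.congr_of_eventuallyEq
    ((eventually_abs_im_lt_of_abs_im_lt hz).mono fun y hy => J1_eq_lambert hτ hy)

lemma differentiableAt_J2 {z : ℂ} (hz : |z.im| < τ.im) : DifferentiableAt ℂ (J2 τ) z := by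
  have hτ : 0 < τ.im := (abs_nonneg _).trans_lt hz
  have hA := differentiableAt_lambert hτ norm_snd_le_weight (abs_lt.1 hz).1
  have hB : DifferentiableAt ℂ (fun y => lambert (fun p => (p.2 : ℂ) + 1) τ (-y)) z :=
    (differentiableAt_lambert hτ norm_snd_le_weight (u := -z)
      (by rw [Complex.neg_im]; linarith [(abs_lt.1 hz).2])).comp z differentiableAt_id.neg
  have h : DifferentiableAt ℂ (fun z => 1 / 6 - 2 * (lambert (fun p => (p.2 : ℂ) + 1) τ z +
      lambert (fun p => (p.2 : ℂ) + 1) τ (-z))) z :=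
    ((hA.add hB).const_mul 2).const_sub _
  exact h.congr_of_eventuallyEq
    ((eventually_abs_im_lt_of_abs_im_lt hz).mono fun y hy => J2_eq_lambert hτ hy)

lemma differentiableAt_J1sqSubJ2 {z : ℂ} (hz : |z.im| < τ.im) (h1 : e z ≠ 1) :
    DifferentiableAt ℂ (J1sqSubJ2 τ) z :=
  ((differentiableAt_J1 hz h1).pow 2).sub (differentiableAt_J2 hz)

lemma tendsto_exp_div_sub_inv_div :
    Tendsto (fun X : ℂ => (Complex.exp X / (Complex.exp X - 1) - 1 / 2 - 1 / X) / X)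
      (𝓝[≠] 0) (𝓝 (1 / 12)) := by
  have hid : Tendsto (fun X : ℂ => X) (𝓝[≠] 0) (𝓝 0) := nhdsWithin_le_nhds
  have hlin : Tendsto (fun X : ℂ => (Complex.exp X - 1) / X) (𝓝[≠] 0) (𝓝 1) := by
    have h := (hasDerivAt_iff_tendsto_slope.1 (Complex.hasDerivAt_exp 0))
    rw [Complex.exp_zero] at h
    refine h.congr fun X => ?_
    rw [slope_def_field, Complex.exp_zero, sub_zero]
  have hrem := ((Complex.exp_sub_sum_range_succ_isLittleO_pow 3).tendsto_div_nhds_zero).mono_left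
    (nhdsWithin_le_nhds (s := {0}ᶜ))
  have hnum : Tendsto (fun X : ℂ => 1 / 6 + X / 6 + (X - 2) *
      ((Complex.exp X - ∑ i ∈ Finset.range (3 + 1), X ^ i / (i.factorial : ℂ)) / X ^ 3))
      (𝓝[≠] 0) (𝓝 (1 / 6 + 0 / 6 + (0 - 2) * 0)) :=
    (tendsto_const_nhds.add (hid.div_const 6)).add ((hid.sub_const 2).mul hrem)
  have hq := hnum.div (hlin.const_mul 2) (by norm_num)
  have hval : ((1 : ℂ) / 6 + 0 / 6 + (0 - 2) * 0) / (2 * 1) = 1 / 12 := by norm_num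
  rw [hval] at hq
  refine hq.congr' ?_
  have hne : ∀ᶠ X : ℂ in 𝓝[≠] 0, Complex.exp X ≠ 1 := by
    have := (Complex.hasDerivAt_exp 0).eventually_ne (c := 1) (Complex.exp_ne_zero _)
    exact this
  filter_upwards [hne, self_mem_nhdsWithin] with X hX hX0
  have h0 : X ≠ 0 := hX0
  have h1 : Complex.exp X - 1 ≠ 0 := sub_ne_zero.2 hX
  simp only [Finset.sum_range_succ, Finset.sum_range_zero, Nat.factorial]
  push_cast
  simp only [Pi.div_apply]
  field_simp
  ring

lemma tendsto_two_pi_I_mul :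
    Tendsto (fun z : ℂ => 2 * Real.pi * Complex.I * z) (𝓝[≠] 0) (𝓝[≠] 0) := by
  refine tendsto_nhdsWithin_iff.2 ⟨?_, ?_⟩
  · have h : Continuous fun z : ℂ => 2 * Real.pi * Complex.I * z := by fun_prop
    simpa using (h.tendsto 0).mono_left nhdsWithin_le_nhds
  · filter_upwards [self_mem_nhdsWithin] with z hz
    exact mul_ne_zero Complex.two_pi_I_ne_zero hz

lemma lambert_fst_zero (τ : ℂ) : lambert (fun p => ((p.1 : ℂ) + 1) * 1) τ 0 =
    lambert (fun p => (p.2 : ℂ) + 1) τ 0 := by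
  rw [lambert, lambert, ← (Equiv.prodComm ℕ ℕ).tsum_eq]
  refine tsum_congr fun p => ?_
  simp only [Equiv.prodComm_apply, Prod.fst_swap, Prod.snd_swap, lambertTerm, mul_one, mul_zero]
  rw [mul_comm ((p.2 : ℂ) + 1)  ((p.1 : ℂ) + 1)]

/-- The linear term in the Laurent expansion of `J₁` at `z = 0`. -/
lemma tendsto_J1_sub_div (hτ : 0 < τ.im) :
    Tendsto (fun z => (J1 τ z - 1 / (2 * Real.pi * Complex.I * z)) / (2 * Real.pi * Complex.I * z))
      (𝓝[≠] 0) (𝓝 (1 / 12 - 2 * lambert (fun p => (p.2 : ℂ) + 1) τ 0)) := by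
  have hπ := Complex.two_pi_I_ne_zero
  have hA := hasDerivAt_lambert hτ norm_one_le_weight (u := 0) (by simpa using hτ)
  have hA' := hA
  rw [← neg_zero] at hA'
  replace hA' := hA'.comp (0 : ℂ) (hasDerivAt_neg (0 : ℂ))
  rw [neg_zero] at hA'
  have hS := ((hasDerivAt_iff_tendsto_slope.1 (hA.sub hA')).div_const
    (2 * Real.pi * Complex.I))
  rw [lambert_fst_zero] at hS
  have h := (tendsto_exp_div_sub_inv_div.comp tendsto_two_pi_I_mul).sub hS
  have hval : (2 * Real.pi * Complex.I * lambert (fun p => (p.2 : ℂ) + 1) τ 0 -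
      2 * Real.pi * Complex.I * lambert (fun p => (p.2 : ℂ) + 1) τ 0 * -1) /
      (2 * Real.pi * Complex.I) = 2 * lambert (fun p => (p.2 : ℂ) + 1) τ 0 := by
    field_simp
    ring
  rw [hval] at h
  refine h.congr' ?_
  filter_upwards [(eventually_abs_im_lt_of_abs_im_lt (τ := τ) (z := 0)
    (by simpa using hτ)).filter_mono nhdsWithin_le_nhds, self_mem_nhdsWithin] with z hz hz0
  have hz0' : z ≠ 0 := hz0
  rw [J1_eq_lambert hτ hz, slope_def_field]
  simp only [Function.comp, Pi.sub_apply, neg_zero, sub_self, sub_zero, e]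
  rw [div_div, mul_comm z, ← sub_div]
  congr 1
  ring

lemma tendsto_J1_sub (hτ : 0 < τ.im) :
    Tendsto (fun z => J1 τ z - 1 / (2 * Real.pi * Complex.I * z)) (𝓝[≠] 0) (𝓝 0) := by
  have h := (tendsto_J1_sub_div hτ).mul
    (tendsto_two_pi_I_mul.mono_right nhdsWithin_le_nhds)
  rw [mul_zero] at h
  refine h.congr' ?_
  filter_upwards [self_mem_nhdsWithin] with z hz
  exact div_mul_cancel₀ _ (mul_ne_zero Complex.two_pi_I_ne_zero hz)

lemma tendsto_J1sqSubJ2_sub (hτ : 0 < τ.im) :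
    Tendsto (fun z => J1sqSubJ2 τ z - 1 / (2 * Real.pi * Complex.I * z) ^ 2) (𝓝[≠] 0) (𝓝 0) := by
  have hX := tendsto_two_pi_I_mul.mono_right (nhdsWithin_le_nhds (a := (0 : ℂ)))
  have h0 : |(0 : ℂ).im| < τ.im := by simpa using hτ
  have hJ2 := (differentiableAt_J2 h0).continuousAt.tendsto.mono_left
    (nhdsWithin_le_nhds (s := {0}ᶜ))
  have h := ((tendsto_J1_sub_div hτ).mul (((tendsto_J1_sub hτ).mul hX).add_const 2)).sub hJ2
  have hval : (1 / 12 - 2 * lambert (fun p => (p.2 : ℂ) + 1) τ 0) * (0 * 0 + 2) - J2 τ 0 = 0 := by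
    rw [J2_eq_lambert hτ h0, neg_zero]
    ring
  rw [hval] at h
  refine h.congr' ?_
  filter_upwards [self_mem_nhdsWithin] with z hz
  have hX0 := mul_ne_zero Complex.two_pi_I_ne_zero hz
  simp only [J1sqSubJ2]
  generalize 2 * Real.pi * Complex.I * z = X at hX0
  field_simp
  ring

lemma glue_J1_add (hτ : 0 < τ.im) (m n : ℤ) (z : ℂ) :
    glue τ (J1 τ) (-1) (z + (m * τ + n)) = glue τ (J1 τ) (-1) z - m := by
  rw [glue_add hτ (J1_add_intCast τ)]
  ring

lemma glue_J1sqSubJ2_add (hτ : 0 < τ.im) (m n : ℤ) (z : ℂ) :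
    glue τ (J1sqSubJ2 τ) 0 (z + (m * τ + n)) = glue τ (J1sqSubJ2 τ) 0 z := by
  rw [glue_add hτ (J1sqSubJ2_add_intCast τ)]
  ring

lemma J1_add_tau' (z : ℂ) (h1 : -τ.im < z.im) (h2 : z.im < 0) :
    J1 τ (z + τ) = J1 τ z + -1 := J1_add_tau z h1 h2

lemma J1sqSubJ2_add_tau' (z : ℂ) (h1 : -τ.im < z.im) (h2 : z.im < 0) :
    J1sqSubJ2 τ (z + τ) = J1sqSubJ2 τ z + 0 := by
  rw [J1sqSubJ2_add_tau z h1 h2, add_zero]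

lemma eventually_glue_eq {f : ℂ → ℂ} {s : ℂ} (hτ : 0 < τ.im)
    (hshift : ∀ z : ℂ, -τ.im < z.im → z.im < 0 → f (z + τ) = f z + s) :
    ∀ᶠ z in 𝓝[≠] 0, f z = glue τ f s z := by
  filter_upwards [(eventually_abs_im_lt_of_abs_im_lt (τ := τ) (z := 0)
    (by simpa using hτ)).filter_mono nhdsWithin_le_nhds] with z hz
  exact (glue_eq_self hshift hz).symm

lemma tendsto_glue_J1_sub (hτ : 0 < τ.im) :
    Tendsto (fun z => glue τ (J1 τ) (-1) z - 1 / (2 * Real.pi * Complex.I * z)) (𝓝[≠] 0) (𝓝 0) :=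
  (tendsto_J1_sub hτ).congr' ((eventually_glue_eq hτ J1_add_tau').mono fun z hz => by rw [hz])

lemma tendsto_glue_J1sqSubJ2_sub (hτ : 0 < τ.im) :
    Tendsto (fun z => glue τ (J1sqSubJ2 τ) 0 z - 1 / (2 * Real.pi * Complex.I * z) ^ 2)
      (𝓝[≠] 0) (𝓝 0) :=
  (tendsto_J1sqSubJ2_sub hτ).congr'
    ((eventually_glue_eq hτ J1sqSubJ2_add_tau').mono fun z hz => by rw [hz])

end Deformed

section Modular

variable {a b c d : ℤ} {τ : ℂ}

lemma lattice_div_eq (hdet : a * d - b * c = 1) (hw : (c : ℂ) * τ + d ≠ 0) (m n : ℤ) (z : ℂ) :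
    (z + (m * τ + n)) / (c * τ + d) = z / (c * τ + d) +
      (((m * d - n * c : ℤ) : ℂ) * ((a * τ + b) / (c * τ + d)) + ((n * a - m * b : ℤ) : ℂ)) := by
  have hdet' : (a : ℂ) * d - b * c = 1 := by exact_mod_cast hdet
  rw [add_div, add_right_inj, div_eq_iff hw, add_mul, mul_assoc, div_mul_cancel₀ _ hw]
  push_cast
  linear_combination -(m * τ + n) * hdet'

lemma onLattice_of_div (hw : (c : ℂ) * τ + d ≠ 0) {z : ℂ}
    (h : OnLattice ((a * τ + b) / (c * τ + d)) (z / (c * τ + d))) : OnLattice τ z := by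
  obtain ⟨m, n, h⟩ := h
  refine ⟨m * a + n * c, m * b + n * d, ?_⟩
  field_simp at h
  push_cast
  linear_combination h

lemma tendsto_div_const_punctured {w : ℂ} (hw : w ≠ 0) :
    Tendsto (fun z : ℂ => z / w) (𝓝[≠] 0) (𝓝[≠] 0) := by
  refine tendsto_nhdsWithin_iff.2 ⟨?_, ?_⟩
  · have h : Continuous fun z : ℂ => z / w := by fun_prop
    simpa using (h.tendsto 0).mono_left nhdsWithin_le_nhds
  · filter_upwards [self_mem_nhdsWithin] with z hz
    exact div_ne_zero hz hw

/-- The extended `J₁` is quasi-modular of weight `1`. -/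
lemma glue_J1_div (hdet : a * d - b * c = 1) (hτ : 0 < τ.im)
    (hτ' : 0 < (((a : ℂ) * τ + b) / (c * τ + d)).im) (hw : (c : ℂ) * τ + d ≠ 0) {z : ℂ}
    (hz : ¬ OnLattice τ z) :
    glue ((a * τ + b) / (c * τ + d)) (J1 ((a * τ + b) / (c * τ + d))) (-1) (z / (c * τ + d)) =
      (c * τ + d) * glue τ (J1 τ) (-1) z + c * z := by
  set τ' := ((a : ℂ) * τ + b) / (c * τ + d) with hτ'def
  set w := (c : ℂ) * τ + d with hwdef
  have key := eq_of_periodic_of_tendsto (v := 0) hτ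
    (D := fun z => (glue τ' (J1 τ') (-1) (z / w) - c * z) / w - glue τ (J1 τ) (-1) z)
    (fun m n z => ?_) (fun z hz => ?_) ?_ hz
  · field_simp at key
    linear_combination key
  · rw [lattice_div_eq hdet hw, glue_J1_add hτ', glue_J1_add hτ, ← hwdef]
    field_simp
    push_cast
    rw [hwdef]
    ring
  · have h1 : DifferentiableAt ℂ (glue τ' (J1 τ') (-1)) (z / w) :=
      differentiableAt_glue hτ' J1_add_tau' (fun _ => differentiableAt_J1)
        (mt (onLattice_of_div hw) hz)
    have h2 : DifferentiableAt ℂ (glue τ (J1 τ) (-1)) z :=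
      differentiableAt_glue hτ J1_add_tau' (fun _ => differentiableAt_J1) hz
    have h3 : DifferentiableAt ℂ (fun z => glue τ' (J1 τ') (-1) (z / w)) z :=
      DifferentiableAt.comp (g := glue τ' (J1 τ') (-1)) z h1 (differentiableAt_id.div_const w)
    exact ((h3.sub (differentiableAt_id.const_mul _)).div_const w).sub h2
  · have hid : Tendsto (fun X : ℂ => X) (𝓝[≠] 0) (𝓝 0) := nhdsWithin_le_nhds
    have h := (((((tendsto_glue_J1_sub hτ').comp (tendsto_div_const_punctured hw))).sub
      (hid.const_mul (c : ℂ))).div_const w).sub (tendsto_glue_J1_sub hτ)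
    simp only [mul_zero, sub_zero, zero_div] at h
    refine h.congr' ?_
    filter_upwards [self_mem_nhdsWithin] with z hz
    have hz' : z ≠ 0 := hz
    have := Complex.two_pi_I_ne_zero
    simp only [Function.comp]
    field_simp
    ring

/-- The extension of `J₁² - J₂` is modular of weight `2`. -/
lemma glue_J1sqSubJ2_div (hdet : a * d - b * c = 1) (hτ : 0 < τ.im)
    (hτ' : 0 < (((a : ℂ) * τ + b) / (c * τ + d)).im) (hw : (c : ℂ) * τ + d ≠ 0) {z : ℂ}
    (hz : ¬ OnLattice τ z) :
    glue ((a * τ + b) / (c * τ + d)) (J1sqSubJ2 ((a * τ + b) / (c * τ + d))) 0 (z / (c * τ + d)) =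
      (c * τ + d) ^ 2 * glue τ (J1sqSubJ2 τ) 0 z := by
  set τ' := ((a : ℂ) * τ + b) / (c * τ + d) with hτ'def
  set w := (c : ℂ) * τ + d with hwdef
  have key := eq_of_periodic_of_tendsto (v := 0) hτ
    (D := fun z => glue τ' (J1sqSubJ2 τ') 0 (z / w) / w ^ 2 - glue τ (J1sqSubJ2 τ) 0 z)
    (fun m n z => ?_) (fun z hz => ?_) ?_ hz
  · field_simp at key
    linear_combination key
  · rw [lattice_div_eq hdet hw, glue_J1sqSubJ2_add hτ', glue_J1sqSubJ2_add hτ, ← hwdef]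
  · have h1 : DifferentiableAt ℂ (glue τ' (J1sqSubJ2 τ') 0) (z / w) :=
      differentiableAt_glue hτ' J1sqSubJ2_add_tau' (fun _ => differentiableAt_J1sqSubJ2)
        (mt (onLattice_of_div hw) hz)
    have h2 : DifferentiableAt ℂ (glue τ (J1sqSubJ2 τ) 0) z :=
      differentiableAt_glue hτ J1sqSubJ2_add_tau' (fun _ => differentiableAt_J1sqSubJ2) hz
    have h3 : DifferentiableAt ℂ (fun z => glue τ' (J1sqSubJ2 τ') 0 (z / w)) z :=
      DifferentiableAt.comp (g := glue τ' (J1sqSubJ2 τ') 0) z h1 (differentiableAt_id.div_const w)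
    exact (h3.div_const (w ^ 2)).sub h2
  · have h := (((tendsto_glue_J1sqSubJ2_sub hτ').comp
      (tendsto_div_const_punctured hw)).div_const (w ^ 2)).sub (tendsto_glue_J1sqSubJ2_sub hτ)
    simp only [sub_zero, zero_div] at h
    refine h.congr' ?_
    filter_upwards [self_mem_nhdsWithin] with z hz
    have hz' : z ≠ 0 := hz
    have := Complex.two_pi_I_ne_zero
    simp only [Function.comp]
    field_simp
    ring

/-- Transformation of `J₁` and `J₂` under the Jacobi group on `D'`. -/
lemma J1_J2_jacobi (hdet : a * d - b * c = 1) (lam mu : ℤ) {z : ℂ} (hmem : (τ, z) ∈ D')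
    (hmem' : ((a * τ + b) / (c * τ + d), (z + lam * τ + mu) / (c * τ + d)) ∈ D') :
    J1 ((a * τ + b) / (c * τ + d)) ((z + lam * τ + mu) / (c * τ + d)) =
        (c * τ + d) * (J1 τ z - lam) + c * (z + lam * τ + mu) ∧
      J2 ((a * τ + b) / (c * τ + d)) ((z + lam * τ + mu) / (c * τ + d)) =
        ((c * τ + d) * (J1 τ z - lam) + c * (z + lam * τ + mu)) ^ 2 -
          (c * τ + d) ^ 2 * (J1 τ z ^ 2 - J2 τ z) := by
  obtain ⟨hτ, hz, hz1⟩ := hmem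
  obtain ⟨hτ', hz', hz1'⟩ := hmem'
  simp only at hτ hz hz1 hτ' hz' hz1'
  have hw : (c : ℂ) * τ + d ≠ 0 := fun h => by simp [h] at hτ'
  have hassoc : z + lam * τ + mu = z + (lam * τ + mu) := add_assoc _ _ _
  have hnot : ¬ OnLattice τ (z + lam * τ + mu) := by
    rw [hassoc, onLattice_add_iff, onLattice_iff_of_abs_im_lt 0 (by simpa using hz)]
    simpa using hz1
  have h1 := glue_J1_div hdet hτ hτ' hw hnot
  have h2 := glue_J1sqSubJ2_div hdet hτ hτ' hw hnot
  rw [glue_eq_self J1_add_tau' hz', hassoc, glue_J1_add hτ, glue_eq_self J1_add_tau' hz,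
    ← hassoc] at h1
  rw [glue_eq_self J1sqSubJ2_add_tau' hz', hassoc, glue_J1sqSubJ2_add hτ,
    glue_eq_self J1sqSubJ2_add_tau' hz, ← hassoc, J1sqSubJ2, J1sqSubJ2] at h2
  refine ⟨h1, ?_⟩
  rw [← h1]
  linear_combination -h2

end Modular

section Modularity

theorem E2_eq_eisensteinSeries (t : UpperHalfPlane) : E2 (t : ℂ) = EisensteinSeries.E2 t := by
  rw [EisensteinSeries.E2_eq_tsum_cexp, tsum_pnat_eq_tsum_succ
    (f := fun n ↦ (ArithmeticFunction.sigma 1 n : ℂ) *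
      Complex.exp (2 * Real.pi * Complex.I * (t : ℂ)) ^ n), E2]
  congr 2
  refine tsum_congr fun n ↦ ?_
  rw [ArithmeticFunction.sigma_one_apply, sigma1, ← Complex.exp_nat_mul, e]
  congr 2
  push_cast
  ring

theorem E2_modular {a b c d : ℤ} {τ : ℂ} (hτ : 0 < τ.im) (hdet : a * d - b * c = 1) :
    E2 ((a * τ + b) / (c * τ + d)) =
      (c * τ + d) ^ 2 * E2 τ + 12 * c * (c * τ + d) / (2 * Real.pi * Complex.I) := by
  let t : UpperHalfPlane := ⟨τ, hτ⟩
  let γ : Matrix.SpecialLinearGroup (Fin 2) ℤ :=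
    ⟨!![a, b; c, d], by rw [Matrix.det_fin_two_of]; exact hdet⟩
  have hcoe : ((γ • t : UpperHalfPlane) : ℂ) = (a * τ + b) / (c * τ + d) := by
    rw [UpperHalfPlane.coe_specialLinearGroup_apply]
    simp [γ, t]
  have hden : UpperHalfPlane.denom γ t = c * τ + d := by
    rw [ModularGroup.denom_apply]
    simp [γ, t]
  have hw : (c * τ + d : ℂ) ≠ 0 := hden ▸ UpperHalfPlane.denom_ne_zero γ t
  have h := congrFun (EisensteinSeries.E2_slash_action γ) t
  rw [ModularForm.SL_slash_apply, hden, ← E2_eq_eisensteinSeries, hcoe, Pi.sub_apply,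
    ← E2_eq_eisensteinSeries, Pi.smul_apply, EisensteinSeries.D2, hden, riemannZeta_two] at h
  have hpi : (Real.pi : ℂ) ≠ 0 := by exact_mod_cast Real.pi_ne_zero
  have hI := Complex.I_sq
  have hI0 := Complex.I_ne_zero
  have hγ : γ 1 0 = c := rfl
  have ht : (t : ℂ) = τ := rfl
  rw [hγ, ht, zpow_neg, mul_inv_eq_iff_eq_mul₀ (zpow_ne_zero _ hw), smul_eq_mul] at h
  rw [h]
  field_simp
  linear_combination (-12 * c) * hI

end Modularity

section Derivative

/-- The exponent of the automorphy factor in the slash action of index `m`. -/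
def cocycle (c d lam mu : ℤ) (t y : ℂ) : ℂ :=
  -(c : ℂ) * (y + (lam : ℂ) * t + (mu : ℂ)) ^ 2 / ((c : ℂ) * t + (d : ℂ)) +
    (lam : ℂ) ^ 2 * t + 2 * (lam : ℂ) * y

variable {a b c d lam mu : ℤ} {τ z : ℂ}

theorem hasDerivAt_den : HasDerivAt (fun t : ℂ ↦ (c : ℂ) * t + (d : ℂ)) c τ := by
  simpa using ((hasDerivAt_id τ).const_mul (c : ℂ)).add_const (d : ℂ)

theorem hasDerivAt_num_left :
    HasDerivAt (fun t : ℂ ↦ z + (lam : ℂ) * t + (mu : ℂ)) lam τ := by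
  simpa using (((hasDerivAt_id τ).const_mul (lam : ℂ)).const_add z).add_const (mu : ℂ)

theorem hasDerivAt_num_right :
    HasDerivAt (fun y : ℂ ↦ y + (lam : ℂ) * τ + (mu : ℂ)) 1 z := by
  simpa using ((hasDerivAt_id z).add_const ((lam : ℂ) * τ)).add_const (mu : ℂ)

theorem hasDerivAt_cocycle_left (hw : (c : ℂ) * τ + d ≠ 0) :
    HasDerivAt (fun t ↦ cocycle c d lam mu t z)
      (-(c : ℂ) * (2 * (z + lam * τ + mu) * lam * (c * τ + d) - (z + lam * τ + mu) ^ 2 * c) /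
        (c * τ + d) ^ 2 + lam ^ 2) τ := by
  have h := (((((hasDerivAt_num_left (lam := lam) (mu := mu) (z := z) (τ := τ)).pow 2).const_mul
    (-(c : ℂ))).div hasDerivAt_den hw).add ((hasDerivAt_id τ).const_mul ((lam : ℂ) ^ 2))).add_const
    (2 * (lam : ℂ) * z)
  refine h.congr_deriv ?_
  simp
  ring

theorem hasDerivAt_cocycle_right :
    HasDerivAt (fun y ↦ cocycle c d lam mu τ y)
      (-(c : ℂ) * (2 * (z + lam * τ + mu)) / (c * τ + d) + 2 * lam) z := by
  have h := (((((hasDerivAt_num_right (lam := lam) (mu := mu) (z := z) (τ := τ)).pow 2).const_mul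
    (-(c : ℂ))).div_const ((c : ℂ) * τ + d)).add_const ((lam : ℂ) ^ 2 * τ)).add
    ((hasDerivAt_id z).const_mul (2 * (lam : ℂ)))
  refine h.congr_deriv ?_
  simp

/-- Partial derivatives of a differentiable function along a curve. -/
theorem hasDerivAt_comp₂ {φ : ℂ → ℂ → ℂ} {u v : ℂ → ℂ} {u' v' s : ℂ}
    (hφ : DifferentiableAt ℂ (fun p : ℂ × ℂ ↦ φ p.1 p.2) (u s, v s))
    (hu : HasDerivAt u u' s) (hv : HasDerivAt v v' s) :
    HasDerivAt (fun x ↦ φ (u x) (v x))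
      (deriv (fun t ↦ φ t (v s)) (u s) * u' + deriv (fun y ↦ φ (u s) y) (v s) * v') s := by
  have key {f g : ℂ → ℂ} {f' g' r : ℂ} (hp : (f r, g r) = (u s, v s)) (hf : HasDerivAt f f' r)
      (hg : HasDerivAt g g' r) : HasDerivAt (fun x ↦ φ (f x) (g x))
        (fderiv ℂ (fun p : ℂ × ℂ ↦ φ p.1 p.2) (u s, v s) (f', g')) r :=
    HasFDerivAt.comp_hasDerivAt (f := fun x ↦ (f x, g x)) (l := fun p : ℂ × ℂ ↦ φ p.1 p.2) r
      (hp ▸ hφ.hasFDerivAt) (hf.prodMk hg)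
  have h1 := (key (f := fun t ↦ t) (g := fun _ ↦ v s) rfl (hasDerivAt_id (u s))
    (hasDerivAt_const _ _)).deriv
  have h2 := (key (f := fun _ ↦ u s) (g := fun y ↦ y) rfl (hasDerivAt_const _ _)
    (hasDerivAt_id (v s))).deriv
  refine (key rfl hu hv).congr_deriv ?_
  rw [h1, h2, mul_comm _ u', mul_comm _ v', ← smul_eq_mul, ← smul_eq_mul, ← map_smul, ← map_smul,
    ← map_add]
  simp

variable {k m : ℤ} {φ : ℂ → ℂ → ℂ}

theorem deriv_slash_right
    (hφ : DifferentiableAt ℂ (fun p : ℂ × ℂ ↦ φ p.1 p.2)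
      (((a : ℂ) * τ + b) / (c * τ + d), (z + lam * τ + mu) / (c * τ + d))) :
    deriv (fun y ↦ slash k m a b c d lam mu φ τ y) z =
      ((c : ℂ) * τ + d) ^ (-k) * e (m * cocycle c d lam mu τ z) *
        (2 * Real.pi * Complex.I * m *
          (-(c : ℂ) * (2 * (z + lam * τ + mu)) / (c * τ + d) + 2 * lam) *
          φ ((a * τ + b) / (c * τ + d)) ((z + lam * τ + mu) / (c * τ + d)) +
        deriv (fun y ↦ φ ((a * τ + b) / (c * τ + d)) y) ((z + lam * τ + mu) / (c * τ + d)) /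
          (c * τ + d)) := by
  have h1 := ((hasDerivAt_e _).comp z
    ((hasDerivAt_cocycle_right (c := c) (d := d) (lam := lam) (mu := mu) (τ := τ)
      (z := z)).const_mul (m : ℂ))).const_mul
    (((c : ℂ) * τ + d) ^ (-k))
  have h2 := hasDerivAt_comp₂ (u := fun _ ↦ ((a : ℂ) * τ + b) / (c * τ + d))
    (v := fun y ↦ (y + lam * τ + mu) / (c * τ + d)) (s := z) hφ
    (hasDerivAt_const z _)
    ((hasDerivAt_num_right (lam := lam) (mu := mu) (z := z) (τ := τ)).div_const ((c : ℂ) * τ + d))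
  refine ((h1.mul h2).congr_deriv ?_).deriv
  simp only [Function.comp]
  ring

theorem deriv_slash_left (hdet : a * d - b * c = 1) (hw : (c : ℂ) * τ + d ≠ 0)
    (hφ : DifferentiableAt ℂ (fun p : ℂ × ℂ ↦ φ p.1 p.2)
      (((a : ℂ) * τ + b) / (c * τ + d), (z + lam * τ + mu) / (c * τ + d))) :
    deriv (fun t ↦ slash k m a b c d lam mu φ t z) τ =
      ((c : ℂ) * τ + d) ^ (-k) * e (m * cocycle c d lam mu τ z) *
        ((-k * c / (c * τ + d) + 2 * Real.pi * Complex.I * m *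
          (-(c : ℂ) * (2 * (z + lam * τ + mu) * lam * (c * τ + d) - (z + lam * τ + mu) ^ 2 * c) /
            (c * τ + d) ^ 2 + lam ^ 2)) *
          φ ((a * τ + b) / (c * τ + d)) ((z + lam * τ + mu) / (c * τ + d)) +
        deriv (fun t ↦ φ t ((z + lam * τ + mu) / (c * τ + d))) ((a * τ + b) / (c * τ + d)) /
          (c * τ + d) ^ 2 +
        deriv (fun y ↦ φ ((a * τ + b) / (c * τ + d)) y) ((z + lam * τ + mu) / (c * τ + d)) *
          ((lam * (c * τ + d) - (z + lam * τ + mu) * c) / (c * τ + d) ^ 2)) := by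
  have hdet' : (a : ℂ) * d - b * c = 1 := by exact_mod_cast hdet
  have h0 := (hasDerivAt_zpow (-k) ((c : ℂ) * τ + d) (Or.inl hw)).comp τ
    (hasDerivAt_den (c := c) (d := d) (τ := τ))
  have h1 := h0.mul ((hasDerivAt_e _).comp τ
    ((hasDerivAt_cocycle_left (lam := lam) (mu := mu) (z := z) hw).const_mul (m : ℂ)))
  have h2 := hasDerivAt_comp₂ (u := fun t ↦ ((a : ℂ) * t + b) / (c * t + d))
    (v := fun t ↦ (z + lam * t + mu) / (c * t + d)) (s := τ) hφ
    ((hasDerivAt_den (c := a) (d := b) (τ := τ)).div hasDerivAt_den hw)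
    ((hasDerivAt_num_left (lam := lam) (mu := mu) (z := z) (τ := τ)).div hasDerivAt_den hw)
  refine ((h1.mul h2).congr_deriv ?_).deriv
  have h3 : (a : ℂ) * (c * τ + d) - (a * τ + b) * c = 1 := by linear_combination hdet'
  simp only [Function.comp, h3, zpow_sub_one₀ hw, Pi.mul_apply]
  push_cast
  ring

end Derivative

/-- the Oberdieck derivative of a Jacobi-invariant holomorphic function of
weight `k` and index `m` is Jacobi-invariant of weight `k+2` and index `m` on `D'`. -/
theorem statement0 (k m : ℕ) (hk : 0 < k) (hm : 0 < m) (φ : ℂ → ℂ → ℂ)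
    (hhol : ∀ τ z : ℂ, 0 < τ.im → DifferentiableAt ℂ (fun p : ℂ × ℂ => φ p.1 p.2) (τ, z))
    (hinv : ∀ a b c d lam mu : ℤ, a * d - b * c = 1 →
      ∀ τ z : ℂ, 0 < τ.im → slash (k : ℤ) (m : ℤ) a b c d lam mu φ τ z = φ τ z)
    (a b c d lam mu : ℤ) (hdet : a * d - b * c = 1) (τ z : ℂ)
    (hmem : (τ, z) ∈ D')
    (hmem' : (((a : ℂ) * τ + (b : ℂ)) / ((c : ℂ) * τ + (d : ℂ)),
      (z + (lam : ℂ) * τ + (mu : ℂ)) / ((c : ℂ) * τ + (d : ℂ))) ∈ D') :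
    slash ((k : ℤ) + 2) (m : ℤ) a b c d lam mu (Ober k m φ) τ z = Ober k m φ τ z := by
  have hτ : 0 < τ.im := hmem.1
  have hτ' := hmem'.1
  have hw : (c : ℂ) * τ + d ≠ 0 := fun h ↦ by simp [h] at hτ'
  have hφ := hhol _ ((z + (lam : ℂ) * τ + mu) / (c * τ + d)) hτ'
  have hpi : (Real.pi : ℂ) ≠ 0 := by exact_mod_cast Real.pi_ne_zero
  have hI0 := Complex.I_ne_zero
  obtain ⟨hJ1, hJ2⟩ := J1_J2_jacobi hdet lam mu hmem hmem'
  have hz : deriv (fun y ↦ φ τ y) z = _ :=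
    (congrArg (deriv · z) (funext fun y ↦ (hinv a b c d lam mu hdet τ y hτ).symm)).trans
      (deriv_slash_right hφ)
  have hev : (fun t ↦ φ t z) =ᶠ[nhds τ] fun t ↦ slash k m a b c d lam mu φ t z :=
    Filter.mem_of_superset ((isOpen_lt continuous_const Complex.continuous_im).mem_nhds hτ)
      fun t ht ↦ (hinv a b c d lam mu hdet t z ht).symm
  have ht := hev.deriv_eq.trans (deriv_slash_left hdet hw hφ)
  have h0 := (hinv a b c d lam mu hdet τ z hτ).symm
  simp only [slash, Ober, Dt, Dz] at h0 ⊢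
  rw [hz, ht, h0, hJ1, hJ2, E2_modular hτ hdet, show -((k : ℤ) + 2) = -(k : ℤ) - 2 by ring,
    zpow_sub₀ hw]
  simp only [cocycle, Int.cast_natCast]
  generalize ((c : ℂ) * τ + d) ^ (-(k : ℤ)) = P
  generalize e _ = Q
  generalize deriv (fun t ↦ φ t ((z + (lam : ℂ) * τ + mu) / (c * τ + d)))
    ((a * τ + b) / (c * τ + d)) = A
  generalize deriv (fun y ↦ φ ((a * τ + b) / (c * τ + d)) y)
    ((z + (lam : ℂ) * τ + mu) / (c * τ + d)) = B
  generalize φ _ _ = F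
  generalize E2 τ = G
  generalize J1 τ z = J
  generalize J2 τ z = K
  set N := z + (lam : ℂ) * τ + mu
  generalize (c : ℂ) * τ + d = w at hw ⊢
  field_simp
  ring
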